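/- arXiv:1805.07330 — 2 statements merged into one kernel-verified Lean document; each statement's English description precedes it below -/
import Mathlib

section
/- For all natural numbers n and k with 1 ≤ k ≤ n, the following integral identity holds: ∫₀¹ ( Σ_{i=0}^{n-k} C(n-1-i, k-1) · (1-x)^{n-k-i} · x^k ) dx = 1 - k/(n+1), where C(a,b) denotes the binomial coefficient. -/
open Finset

theorem integral_one_sub_pow_mul_pow (a j : ℕ) :
    ∫ x in (0:ℝ)..1, (1 - x) ^ j * x ^ a
      = (a.factorial : ℝ) * j.factorial / (a + j + 1).factorial := by
  induction j generalizing a with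
  | zero =>
    simp only [pow_zero, one_mul, integral_pow, Nat.factorial_zero, Nat.add_zero,
      Nat.factorial_succ]
    push_cast
    field_simp
    simp
  | succ j ih =>
    have h_split : ∀ x : ℝ, (1 - x) ^ (j + 1) * x ^ a
        = (1 - x) ^ j * x ^ a - (1 - x) ^ j * x ^ (a + 1) := fun x => by ring
    simp only [h_split]
    rw [intervalIntegral.integral_sub (Continuous.intervalIntegrable (by fun_prop) _ _)
      (Continuous.intervalIntegrable (by fun_prop) _ _), ih, ih,
      show a + 1 + j + 1 = a + j + 1 + 1 by ring, show a + (j + 1) + 1 = a + j + 1 + 1 by ring,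
      Nat.factorial_succ (a + j + 1), Nat.factorial_succ a, Nat.factorial_succ j]
    push_cast
    field_simp
    ring

theorem integral_choose_mul_one_sub_pow_mul_pow (m j : ℕ) :
    ∫ x in (0:ℝ)..1, ((m + j).choose m : ℝ) * (1 - x) ^ j * x ^ (m + 1)
      = (m + 1) / ((m + j + 1) * (m + j + 2)) := by
  simp only [mul_assoc]
  rw [intervalIntegral.integral_const_mul, integral_one_sub_pow_mul_pow, Nat.cast_add_choose,
    show m + 1 + j + 1 = m + j + 1 + 1 by ring, Nat.factorial_succ (m + j + 1),
    Nat.factorial_succ (m + j), Nat.factorial_succ m]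
  push_cast
  field_simp
  ring

theorem sum_range_div_mul_succ (m d : ℕ) :
    ∑ j ∈ range d, ((m : ℝ) + 1) / ((m + j + 1) * (m + j + 2))
      = 1 - (m + 1) / (m + d + 1) := by
  induction d with
  | zero =>
    have h : (m : ℝ) + 1 ≠ 0 := by positivity
    simp [h]
  | succ d ih =>
    rw [sum_range_succ, ih]
    push_cast
    rw [show (m : ℝ) + (d + 1) + 1 = m + d + 2 by ring]
    field_simp
    ring

theorem integral_sum_binom_eq (n k : ℕ) (hk : 1 ≤ k) (hkn : k ≤ n) :
    ∫ x in (0:ℝ)..1,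
        (∑ i ∈ Finset.range (n - k + 1),
          ((n - 1 - i).choose (k - 1) : ℝ) * (1 - x) ^ (n - k - i) * x ^ k)
      = 1 - (k : ℝ) / (n + 1) := by
  obtain ⟨m, rfl⟩ := Nat.exists_eq_add_of_le' hk
  obtain ⟨d, rfl⟩ := Nat.exists_eq_add_of_le hkn
  have h_reflect : ∀ x : ℝ, ∑ i ∈ range (m + 1 + d - (m + 1) + 1),
      ((m + 1 + d - 1 - i).choose (m + 1 - 1) : ℝ) * (1 - x) ^ (m + 1 + d - (m + 1) - i)
        * x ^ (m + 1)
      = ∑ j ∈ range (d + 1), ((m + j).choose m : ℝ) * (1 - x) ^ j * x ^ (m + 1) := by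
    intro x
    rw [← sum_range_reflect _ (d + 1), Nat.add_sub_cancel_left]
    refine sum_congr rfl fun i hi => ?_
    have hid : i ≤ d := Nat.lt_succ_iff.mp (mem_range.mp hi)
    rw [show m + 1 + d - 1 - i = m + (d - i) by omega, show d + 1 - 1 - i = d - i by omega,
      Nat.add_sub_cancel]
  simp only [h_reflect]
  rw [intervalIntegral.integral_finsetSum fun j _ =>
    Continuous.intervalIntegrable (by fun_prop) _ _]
  simp only [integral_choose_mul_one_sub_pow_mul_pow]
  rw [sum_range_div_mul_succ]
  push_cast
  ring
end

section
/- For all natural numbers n and k with 1 ≤ k ≤ n, the following integral identity holds: ∫₀¹ ( 1 + Σ_{i=k}^{n} (-1)^{i+k-1} · C(n,i) · C(i-1, k-1) · x^i ) dx = k/(n+1), where C(a,b) denotes the binomial coefficient. -/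
open Finset

theorem sum_neg_one_pow_mul_choose_mul_choose (n a : ℕ) :
    ∑ j ∈ range (n + 1), (-1 : ℤ) ^ j * n.choose j * j.choose a =
      if n = a then (-1) ^ a else 0 := by
  have h := fwdDiff_iter_choose_zero a n
  rw [fwdDiff_iter_eq_sum_shift] at h
  simp only [smul_eq_mul, mul_one, zero_add] at h
  have h2 : ∑ j ∈ range (n + 1), (-1 : ℤ) ^ j * n.choose j * j.choose a =
      (-1) ^ n * ∑ j ∈ range (n + 1), (-1 : ℤ) ^ (n - j) * n.choose j * j.choose a := by
    rw [mul_sum]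
    refine sum_congr rfl fun j hj => ?_
    obtain ⟨d, rfl⟩ := Nat.exists_eq_add_of_le (Nat.lt_succ_iff.mp (mem_range.mp hj))
    have hd : (-1 : ℤ) ^ d * (-1) ^ d = 1 := by rw [← mul_pow]; simp
    rw [Nat.add_sub_cancel_left, pow_add]
    linear_combination (-(-1 : ℤ) ^ j * (j + d).choose j * j.choose a) * hd
  rw [h2, h]
  split_ifs with hna <;> simp [hna]

theorem sum_neg_one_pow_mul_choose_succ_mul_choose {n a : ℕ} (h : a ≤ n) :
    ∑ j ∈ range (n + 1), (-1 : ℤ) ^ j * (n + 1).choose (j + 1) * j.choose a = (-1) ^ a := by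
  induction n, h using Nat.le_induction with
  | base =>
    rw [sum_range_succ, sum_eq_zero]
    · simp
    · intro j hj
      simp [Nat.choose_eq_zero_of_lt (mem_range.mp hj)]
  | succ n h ih =>
    have hV := sum_neg_one_pow_mul_choose_mul_choose (n + 1) a
    rw [if_neg (by lia)] at hV
    simp only [Nat.choose_succ_succ' (n + 1), Nat.cast_add, mul_add, add_mul, sum_add_distrib]
    rw [hV, sum_range_succ, ih]
    simp

theorem sum_neg_one_pow_mul_choose_add_two_mul_choose {n a : ℕ} (h : a ≤ n) :
    ∑ j ∈ range n, (-1 : ℤ) ^ j * (n + 1).choose (j + 2) * j.choose a = (-1) ^ a * (n - a) := by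
  induction n, h using Nat.le_induction with
  | base =>
    rw [sum_eq_zero]
    · simp
    · intro j hj
      simp [Nat.choose_eq_zero_of_lt (mem_range.mp hj)]
  | succ n h ih =>
    have hU := sum_neg_one_pow_mul_choose_succ_mul_choose h
    simp only [Nat.choose_succ_succ' (n + 1), Nat.cast_add, mul_add, add_mul, sum_add_distrib]
    rw [hU, sum_range_succ, ih]
    simp
    ring

theorem integral_one_add_alt_sum (n k : ℕ) (hk : 1 ≤ k) (hkn : k ≤ n) :
    ∫ x in (0:ℝ)..1,
        (1 + ∑ i ∈ Finset.Icc k n,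
          (-1 : ℝ) ^ (i + k - 1) * (n.choose i : ℝ) * ((i - 1).choose (k - 1) : ℝ) * x ^ i)
      = (k : ℝ) / (n + 1) := by
  obtain ⟨a, rfl⟩ := Nat.exists_eq_add_of_le' hk
  have hn : (n : ℝ) + 1 ≠ 0 := by positivity
  rw [intervalIntegral.integral_add (by simp)
    (Continuous.intervalIntegrable (by fun_prop) _ _),
    intervalIntegral.integral_finsetSum
      fun i _ => Continuous.intervalIntegrable (by fun_prop) _ _]
  simp only [intervalIntegral.integral_const_mul, integral_pow, intervalIntegral.integral_const]
  have hsum : ∑ i ∈ Icc (a + 1) n, (-1 : ℝ) ^ (i + (a + 1) - 1) * (n.choose i : ℝ) *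
      ((i - 1).choose (a + 1 - 1) : ℝ) * ((1 ^ (i + 1) - 0 ^ (i + 1)) / (i + 1)) =
      ∑ j ∈ range n, (-1 : ℝ) ^ (a + 1) / (n + 1) *
        ((-1 : ℝ) ^ j * (n + 1).choose (j + 2) * j.choose a) := by
    rw [← Ico_add_one_right_eq_Icc, ← sum_Ico_add' _ a n 1, range_eq_Ico]
    refine sum_subset_zero_on_sdiff (Ico_subset_Ico_left a.zero_le) ?_ ?_
    · intro j hj
      simp only [mem_sdiff, mem_Ico] at hj
      simp [Nat.choose_eq_zero_of_lt (show j < a by lia)]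
    · intro j _
      have hc : ((n : ℝ) + 1) * n.choose (j + 1) = (n + 1).choose (j + 2) * (j + 2) := by
        exact_mod_cast Nat.add_one_mul_choose_eq n (j + 1)
      have hj : (j : ℝ) + 1 + 1 ≠ 0 := by positivity
      rw [show j + 1 + (a + 1) - 1 = a + 1 + j by lia, pow_add]
      simp only [Nat.add_sub_cancel, Nat.cast_add, Nat.cast_one]
      field_simp
      simp
      linear_combination (j.choose a : ℝ) * hc
  have hT : ∑ j ∈ range n, (-1 : ℝ) ^ j * (n + 1).choose (j + 2) * j.choose a =
      (-1) ^ a * (n - a) := by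
    exact_mod_cast sum_neg_one_pow_mul_choose_add_two_mul_choose (n := n) (a := a) (by lia)
  have ha : (-1 : ℝ) ^ a * (-1) ^ a = 1 := by rw [← mul_pow]; simp
  rw [hsum, ← mul_sum, hT, pow_succ]
  push_cast
  field_simp
  simp
  linear_combination (a - n : ℝ) * ha
end
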